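/- arXiv:1805.04293 — 2 statements merged into one kernel-verified Lean document; each statement's English description precedes it below -/
import Mathlib

section
/- Let a be the densely defined operator on the Fock space A²(ℂ, e^{-|z|²}) given by a(f) = f' with domain dom(a) = {f ∈ A²(ℂ, e^{-|z|²}) : f' ∈ A²(ℂ, e^{-|z|²})}. Then the Hilbert-space adjoint a* of a has domain dom(a*) = {g ∈ A²(ℂ, e^{-|z|²}) : z g(z) ∈ A²(ℂ, e^{-|z|²})} and acts by a*(g)(z) = z g(z); in particular (f', g) = (f, z g) for all f ∈ dom(a) and all g ∈ A²(ℂ, e^{-|z|²}) with z g ∈ A²(ℂ, e^{-|z|²}). -/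
open MeasureTheory Filter Complex

noncomputable section

/-- The Gaussian weight `e^{-|z|^2}` on `ℂ`. -/
def fockWt (z : ℂ) : ℝ := Real.exp (-‖z‖ ^ 2)

/-- The squared norm of the Fock space `A²(ℂ, e^{-|z|²})`:
`‖f‖² = ∫_ℂ |f(z)|² e^{-|z|²} dλ(z)`. -/
def fockNormSq (f : ℂ → ℂ) : ℝ := ∫ z : ℂ, ‖f z‖ ^ 2 * fockWt z

/-- The inner product of the Fock space:
`(f,g) = ∫_ℂ f(z) conj (g(z)) e^{-|z|²} dλ(z)`. -/
def fockInner (f g : ℂ → ℂ) : ℂ := ∫ z : ℂ, f z * (starRingEnd ℂ) (g z) * fockWt z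

/-- Membership in the Fock space `A²(ℂ, e^{-|z|²})`: `f` is entire and
`∫_ℂ |f|² e^{-|z|²} dλ < ∞`. -/
def MemFock (f : ℂ → ℂ) : Prop :=
  Differentiable ℂ f ∧ Integrable (fun z : ℂ => ‖f z‖ ^ 2 * fockWt z)

lemma fockWt_pos (z : ℂ) : 0 < fockWt z := Real.exp_pos _

lemma contDiff_fockWt : ContDiff ℝ 1 fockWt :=
  Real.contDiff_exp.comp (contDiff_norm_sq ℝ).neg

lemma continuous_fockWt : Continuous fockWt := contDiff_fockWt.continuous

lemma fderiv_ofReal_fockWt (z v : ℂ) :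
    fderiv ℝ (fun w : ℂ => (fockWt w : ℂ)) z v =
      -((z * (starRingEnd ℂ) v + (starRingEnd ℂ) z * v) * fockWt z) := by
  have h1 : HasFDerivAt fockWt (Real.exp (-‖z‖ ^ 2) • -((2 : ℕ) • innerSL ℝ z : ℂ →L[ℝ] ℝ)) z :=
    (hasStrictFDerivAt_norm_sq z).hasFDerivAt.neg.exp
  have h2 := ofRealCLM.hasFDerivAt.comp z h1
  rw [show (fun w : ℂ => (fockWt w : ℂ)) = ofRealCLM ∘ fockWt from rfl, h2.fderiv]
  apply Complex.ext <;>
    simp [fockWt, Complex.inner] <;> ring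

lemma integrable_mul_conj_mul_fockWt {f g : ℂ → ℂ} (hf : MemFock f) (hg : MemFock g) :
    Integrable (fun z => f z * (starRingEnd ℂ) (g z) * fockWt z) := by
  refine (hf.2.add hg.2).mono' ?_ (ae_of_all _ fun z => ?_)
  · exact ((hf.1.continuous.mul (continuous_conj.comp hg.1.continuous)).mul
      (continuous_ofReal.comp continuous_fockWt)).aestronglyMeasurable
  · simp only [norm_mul, RCLike.norm_conj, norm_real, Real.norm_eq_abs, abs_of_pos (fockWt_pos z),
      Pi.add_apply]
    rw [← add_mul]
    gcongr
    · exact (fockWt_pos z).le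
    · nlinarith [sq_nonneg (‖f z‖ - ‖g z‖), sq_nonneg (‖f z‖ + ‖g z‖)]

lemma MemFock.add {f g : ℂ → ℂ} (hf : MemFock f) (hg : MemFock g) :
    MemFock (fun z => f z + g z) := by
  refine ⟨hf.1.add hg.1, ((hf.2.add hg.2).const_mul 2).mono' ?_ (ae_of_all _ fun z => ?_)⟩
  · exact (((hf.1.add hg.1).continuous.norm.pow 2).mul continuous_fockWt).aestronglyMeasurable
  · rw [Real.norm_of_nonneg (mul_nonneg (by positivity) (fockWt_pos z).le), Pi.add_apply, ← add_mul,
      ← mul_assoc]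
    refine mul_le_mul_of_nonneg_right ?_ (fockWt_pos z).le
    have := norm_add_le (f z) (g z)
    nlinarith [sq_nonneg (‖f z‖ - ‖g z‖), norm_nonneg (f z + g z), norm_nonneg (f z),
      norm_nonneg (g z)]

lemma MemFock.const_mul {f : ℂ → ℂ} (hf : MemFock f) (c : ℂ) :
    MemFock (fun z => c * f z) := by
  refine ⟨hf.1.const_mul c, (hf.2.const_mul (‖c‖ ^ 2)).congr (ae_of_all _ fun z => ?_)⟩
  simp only [norm_mul]
  ring

lemma memFock_pow (n : ℕ) : MemFock (fun z => z ^ n) := by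
  have hG : Integrable (fun z : ℂ => Real.exp (-(1 / 2) * ‖z‖ ^ 2)) := by
    have h := (GaussianFourier.integrable_cexp_neg_mul_sq_norm_add (V := ℂ) (b := 1 / 2)
      (by norm_num) 0 0).norm
    refine h.congr (ae_of_all _ fun z => ?_)
    simp [Complex.norm_exp, ← ofReal_pow]
  refine ⟨differentiable_pow n,
    (hG.const_mul (2 ^ n * n.factorial : ℝ)).mono' ?_ (ae_of_all _ fun z => ?_)⟩
  · exact (((continuous_pow n).norm.pow 2).mul continuous_fockWt).aestronglyMeasurable
  · rw [Real.norm_of_nonneg (mul_nonneg (by positivity) (fockWt_pos z).le)]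
    have h := Real.pow_div_factorial_le_exp (‖z‖ ^ 2 / 2) (by positivity) n
    have h2 : fockWt z = Real.exp (-(1 / 2) * ‖z‖ ^ 2) * Real.exp (-(1 / 2) * ‖z‖ ^ 2) := by
      rw [fockWt, ← Real.exp_add]; ring_nf
    have h3 : Real.exp (-(1 / 2) * ‖z‖ ^ 2) * Real.exp (‖z‖ ^ 2 / 2) = 1 := by
      rw [← Real.exp_add]; ring_nf; simp
    have h4 : (‖z ^ n‖ ^ 2 : ℝ) = 2 ^ n * n.factorial * ((‖z‖ ^ 2 / 2) ^ n / n.factorial) := by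
      rw [norm_pow, div_pow]
      field_simp
      ring
    calc _ = 2 ^ n * n.factorial * ((‖z‖ ^ 2 / 2) ^ n / n.factorial) *
          (Real.exp (-(1 / 2) * ‖z‖ ^ 2) * Real.exp (-(1 / 2) * ‖z‖ ^ 2)) := by rw [h4, h2]
      _ ≤ 2 ^ n * n.factorial * Real.exp (‖z‖ ^ 2 / 2) *
          (Real.exp (-(1 / 2) * ‖z‖ ^ 2) * Real.exp (-(1 / 2) * ‖z‖ ^ 2)) := by gcongr
      _ = 2 ^ n * n.factorial * Real.exp (-(1 / 2) * ‖z‖ ^ 2) *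
          (Real.exp (-(1 / 2) * ‖z‖ ^ 2) * Real.exp (‖z‖ ^ 2 / 2)) := by ring
      _ = _ := by rw [h3, mul_one]

lemma memFock_eval (p : Polynomial ℂ) : MemFock (fun z => p.eval z) := by
  induction p using Polynomial.induction_on' with
  | add p q hp hq => simpa using hp.add hq
  | monomial n a => simpa using (memFock_pow n).const_mul a

/-- If `h` is entire and `z h(z)` lies in the Fock space, then so does `h`. -/
lemma memFock_of_memFock_mul {h : ℂ → ℂ} (hd : Differentiable ℂ h)
    (hz : MemFock (fun z => z * h z)) : MemFock h := by
  have hc : Continuous (fun z : ℂ => ‖h z‖ ^ 2 * fockWt z) :=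
    (hd.continuous.norm.pow 2).mul continuous_fockWt
  have h1 : IntegrableOn (fun z : ℂ => ‖h z‖ ^ 2 * fockWt z) (Metric.closedBall 0 1) :=
    hc.continuousOn.integrableOn_compact (isCompact_closedBall _ _)
  have h2 : IntegrableOn (fun z : ℂ => ‖h z‖ ^ 2 * fockWt z) (Metric.closedBall 0 1)ᶜ := by
    refine (hz.2.integrableOn).mono' hc.aestronglyMeasurable ?_
    refine (ae_restrict_iff' Metric.isClosed_closedBall.measurableSet.compl).2
      (ae_of_all _ fun z hz1 => ?_)
    have h3 : 1 < ‖z‖ := by simpa using hz1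
    rw [Real.norm_of_nonneg (mul_nonneg (by positivity) (fockWt_pos z).le)]
    refine mul_le_mul_of_nonneg_right ?_ (fockWt_pos z).le
    rw [norm_mul, mul_pow]
    exact le_mul_of_one_le_left (by positivity) (one_le_pow₀ h3.le)
  exact ⟨hd, by rw [← integrableOn_univ, ← Set.union_compl_self]; exact h1.union h2⟩

lemma fockNormSq_nonneg (f : ℂ → ℂ) : 0 ≤ fockNormSq f :=
  integral_nonneg fun z => mul_nonneg (by positivity) (fockWt_pos z).le

lemma norm_fockInner_le {f g : ℂ → ℂ} (hf : MemFock f) (hg : MemFock g) :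
    ‖fockInner f g‖ ≤ Real.sqrt (fockNormSq g) * Real.sqrt (fockNormSq f) := by
  have hi : Integrable (fun z => ‖f z‖ * ‖g z‖ * fockWt z) :=
    (integrable_mul_conj_mul_fockWt hf hg).norm.congr (ae_of_all _ fun z => by
      simp [abs_of_pos (fockWt_pos z)])
  set B := ∫ z, ‖f z‖ * ‖g z‖ * fockWt z
  have hle : ‖fockInner f g‖ ≤ B := by
    refine (norm_integral_le_integral_norm _).trans_eq (integral_congr_ae (ae_of_all _ fun z => ?_))
    simp [abs_of_pos (fockWt_pos z)]
  have hquad : ∀ t : ℝ, 0 ≤ fockNormSq f * (t * t) + (-2 * B) * t + fockNormSq g := by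
    intro t
    have h0 : 0 ≤ ∫ z, (t * ‖f z‖ - ‖g z‖) ^ 2 * fockWt z :=
      integral_nonneg fun z => mul_nonneg (by positivity) (fockWt_pos z).le
    have h1 : ∫ z, (t * ‖f z‖ - ‖g z‖) ^ 2 * fockWt z =
        ∫ z, ((‖f z‖ ^ 2 * fockWt z * (t * t) + ‖f z‖ * ‖g z‖ * fockWt z * (-2 * t)) +
          ‖g z‖ ^ 2 * fockWt z) :=
      integral_congr_ae (ae_of_all _ fun z => by ring)
    have h2 : Integrable (fun z => ‖f z‖ ^ 2 * fockWt z * (t * t) +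
        ‖f z‖ * ‖g z‖ * fockWt z * (-2 * t)) := (hf.2.mul_const _).add (hi.mul_const _)
    rw [h1, integral_add h2 hg.2,
      integral_add (hf.2.mul_const _) (hi.mul_const _), integral_mul_const,
      integral_mul_const] at h0
    simp only [fockNormSq]
    linarith
  have hd := discrim_le_zero hquad
  rw [discrim] at hd
  rw [← Real.sqrt_mul (fockNormSq_nonneg g)]
  exact hle.trans (Real.le_sqrt_of_sq_le (by nlinarith))

lemma contDiff_mul_conj_mul_fockWt {f g : ℂ → ℂ} (hf : Differentiable ℂ f)
    (hg : Differentiable ℂ g) :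
    ContDiff ℝ 1 (fun z => f z * (starRingEnd ℂ) (g z) * (fockWt z : ℂ)) :=
  ((hf.contDiff.restrict_scalars ℝ).mul
    (conjCLE.contDiff.comp (hg.contDiff.restrict_scalars ℝ))).mul
    (ofRealCLM.contDiff.comp contDiff_fockWt)

lemma fderiv_mul_conj_mul_fockWt {f g : ℂ → ℂ} (hf : Differentiable ℂ f)
    (hg : Differentiable ℂ g) (z v : ℂ) :
    fderiv ℝ (fun z => f z * (starRingEnd ℂ) (g z) * (fockWt z : ℂ)) z v =
      (deriv f z * v * (starRingEnd ℂ) (g z) + f z * (starRingEnd ℂ) (deriv g z * v)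
        - f z * (starRingEnd ℂ) (g z) * (z * (starRingEnd ℂ) v + (starRingEnd ℂ) z * v))
        * fockWt z := by
  have h1 := (hf z).hasDerivAt.hasFDerivAt.restrictScalars ℝ
  have h2 := (conjCLE : ℂ →L[ℝ] ℂ).hasFDerivAt.comp z
    ((hg z).hasDerivAt.hasFDerivAt.restrictScalars ℝ)
  have h3 : HasFDerivAt (fun w : ℂ => (fockWt w : ℂ))
      (fderiv ℝ (fun w : ℂ => (fockWt w : ℂ)) z) z :=
    ((ofRealCLM.contDiff.comp contDiff_fockWt).differentiable one_ne_zero z).hasFDerivAt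
  have h4 := (h1.mul h2).mul h3
  have h5 : fderiv ℝ (fun z => f z * (starRingEnd ℂ) (g z) * (fockWt z : ℂ)) z v = _ :=
    congrArg (fun L : ℂ →L[ℝ] ℂ => L v) h4.fderiv
  rw [h5]
  simp [fderiv_ofReal_fockWt]
  ring

/-- Integration by parts for `∂/∂z` against a compactly supported cutoff `χ`. -/
lemma integral_wirtinger_mul_cutoff {f g χ : ℂ → ℂ} (hf : Differentiable ℂ f)
    (hg : Differentiable ℂ g) (hχ : ContDiff ℝ 1 χ) (hs : HasCompactSupport χ) :
    ∫ z, (deriv f z * (starRingEnd ℂ) (g z) * fockWt z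
        - f z * (starRingEnd ℂ) (z * g z) * fockWt z) * χ z =
      -(1 / 2) * ∫ z, f z * (starRingEnd ℂ) (g z) * fockWt z *
        (fderiv ℝ χ z 1 - I * fderiv ℝ χ z I) := by
  set F : ℂ → ℂ := fun z => f z * (starRingEnd ℂ) (g z) * fockWt z with hF
  have hFC : ContDiff ℝ 1 F := contDiff_mul_conj_mul_fockWt hf hg
  have hFd (v : ℂ) : Continuous (fun z => fderiv ℝ F z v) :=
    (hFC.continuous_fderiv one_ne_zero).clm_apply continuous_const
  have hχd (v : ℂ) : Continuous (fun z => fderiv ℝ χ z v) :=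
    (hχ.continuous_fderiv one_ne_zero).clm_apply continuous_const
  have i1 (v : ℂ) : Integrable (fun z => fderiv ℝ F z v * χ z) :=
    ((hFd v).mul hχ.continuous).integrable_of_hasCompactSupport hs.mul_left
  have i2 (v : ℂ) : Integrable (fun z => F z * fderiv ℝ χ z v) :=
    (hFC.continuous.mul (hχd v)).integrable_of_hasCompactSupport (hs.fderiv_apply ℝ v).mul_left
  have i3 : Integrable (fun z => F z * χ z) :=
    (hFC.continuous.mul hχ.continuous).integrable_of_hasCompactSupport hs.mul_left
  have key (v : ℂ) : ∫ z, F z * fderiv ℝ χ z v = - ∫ z, fderiv ℝ F z v * χ z :=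
    integral_mul_fderiv_eq_neg_fderiv_mul_of_integrable (i1 v) (i2 v) i3
      (fun z _ => hFC.differentiable one_ne_zero z) (fun z _ => hχ.differentiable one_ne_zero z)
  have e1 : ∫ z, F z * (fderiv ℝ χ z 1 - I * fderiv ℝ χ z I) =
      (∫ z, F z * fderiv ℝ χ z 1) - I * ∫ z, F z * fderiv ℝ χ z I := by
    rw [← integral_const_mul, ← integral_sub (i2 1) ((i2 I).const_mul I)]
    exact integral_congr_ae (ae_of_all _ fun z => by ring)
  have e2 : ∫ z, (deriv f z * (starRingEnd ℂ) (g z) * fockWt z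
        - f z * (starRingEnd ℂ) (z * g z) * fockWt z) * χ z =
      (1 / 2) * ((∫ z, fderiv ℝ F z 1 * χ z) - I * ∫ z, fderiv ℝ F z I * χ z) := by
    rw [← integral_const_mul I, ← integral_sub (i1 1) ((i1 I).const_mul I), ← integral_const_mul]
    refine integral_congr_ae (ae_of_all _ fun z => ?_)
    simp only [hF, fderiv_mul_conj_mul_fockWt hf hg, map_mul, map_one, conj_I]
    linear_combination (1 / 2 * χ z * fockWt z * (deriv f z * (starRingEnd ℂ) (g z)
      - f z * (starRingEnd ℂ) (deriv g z) + f z * (starRingEnd ℂ) (g z) * (z - (starRingEnd ℂ) z)))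
      * I_mul_I
  rw [e1, e2, key, key]
  ring

theorem fockInner_deriv_eq {f g : ℂ → ℂ} (hf : MemFock f) (hf' : MemFock (deriv f))
    (hg : MemFock g) (hzg : MemFock (fun z => z * g z)) :
    fockInner (deriv f) g = fockInner f (fun z => z * g z) := by
  let φ : ContDiffBump (0 : ℂ) := default
  let ψ : ℂ → ℂ := fun z => (φ z : ℂ)
  have hψC : ContDiff ℝ 1 ψ := ofRealCLM.contDiff.comp φ.contDiff
  have hψs : HasCompactSupport ψ := φ.hasCompactSupport.comp_left ofReal_zero
  obtain ⟨M, hM⟩ := (hψs.fderiv ℝ).exists_bound_of_continuous (hψC.continuous_fderiv one_ne_zero)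
  let c : ℕ → ℝ := fun n => 1 / ((n : ℝ) + 1)
  have hc : Tendsto c atTop (nhds 0) := tendsto_one_div_add_atTop_nhds_zero_nat
  have hc0 (n : ℕ) : 0 < c n := Nat.one_div_pos_of_nat
  let χ : ℕ → ℂ → ℂ := fun n z => ψ (c n • z)
  have hχC (n : ℕ) : ContDiff ℝ 1 (χ n) := hψC.comp (contDiff_const_smul _)
  have hχs (n : ℕ) : HasCompactSupport (χ n) := hψs.comp_smul (hc0 n).ne'
  have hχd (n : ℕ) (z v : ℂ) : ‖fderiv ℝ (χ n) z v‖ ≤ c n * M * ‖v‖ := by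
    have : fderiv ℝ (χ n) z = c n • fderiv ℝ ψ (c n • z) := fderiv_comp_smul ..
    rw [this, smul_apply, norm_smul, Real.norm_of_nonneg (hc0 n).le, mul_assoc]
    exact mul_le_mul_of_nonneg_left ((fderiv ℝ ψ _).le_of_opNorm_le (hM _) v) (hc0 n).le
  have hiF := integrable_mul_conj_mul_fockWt hf hg
  have hi1 := integrable_mul_conj_mul_fockWt hf' hg
  have hi2 := integrable_mul_conj_mul_fockWt hf hzg
  have hlim1 : Tendsto (fun n => ∫ z, (deriv f z * (starRingEnd ℂ) (g z) * fockWt z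
        - f z * (starRingEnd ℂ) (z * g z) * fockWt z) * χ n z) atTop
      (nhds (∫ z, (deriv f z * (starRingEnd ℂ) (g z) * fockWt z
        - f z * (starRingEnd ℂ) (z * g z) * fockWt z))) := by
    refine tendsto_integral_of_dominated_convergence _
      (fun n => (hi1.sub hi2).aestronglyMeasurable.mul (hχC n).continuous.aestronglyMeasurable)
      (hi1.sub hi2).norm (fun n => ae_of_all _ fun z => ?_) (ae_of_all _ fun z => ?_)
    · rw [norm_mul]
      refine mul_le_of_le_one_right (norm_nonneg _) ?_
      simpa [χ, ψ, abs_of_nonneg φ.nonneg] using φ.le_one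
    · have h0 : Tendsto (fun n => χ n z) atTop (nhds (ψ 0)) := by
        refine (hψC.continuous.tendsto 0).comp ?_
        simpa using hc.smul_const z
      have h1 : ψ 0 = 1 := by
        simp [ψ, φ.one_of_mem_closedBall (Metric.mem_closedBall_self φ.rIn_pos.le)]
      simpa [h1] using h0.const_mul (deriv f z * (starRingEnd ℂ) (g z) * fockWt z
        - f z * (starRingEnd ℂ) (z * g z) * fockWt z)
  have hlim2 : Tendsto (fun n => ∫ z, (deriv f z * (starRingEnd ℂ) (g z) * fockWt z
        - f z * (starRingEnd ℂ) (z * g z) * fockWt z) * χ n z) atTop (nhds 0) := by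
    simp_rw [integral_wirtinger_mul_cutoff hf.1 hg.1 (hχC _) (hχs _)]
    rw [← mul_zero (-(1 / 2) : ℂ)]
    refine Tendsto.const_mul _ (squeeze_zero_norm (a := fun n => c n *
      ((∫ z, ‖f z * (starRingEnd ℂ) (g z) * fockWt z‖) * (M + M))) (fun n => ?_) ?_)
    · rw [mul_left_comm, ← integral_mul_const]
      refine norm_integral_le_of_norm_le (hiF.norm.mul_const _) (ae_of_all _ fun z => ?_)
      rw [norm_mul]
      refine mul_le_mul_of_nonneg_left ((norm_sub_le _ _).trans ?_) (norm_nonneg _)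
      have h1 := hχd n z 1
      have h2 := hχd n z I
      rw [norm_one, mul_one] at h1
      rw [norm_I, mul_one] at h2
      rw [norm_mul, norm_I, one_mul, mul_add]
      exact add_le_add h1 h2
    · simpa using hc.mul_const ((∫ z, ‖f z * (starRingEnd ℂ) (g z) * fockWt z‖) * (M + M))
  have h := tendsto_nhds_unique hlim1 hlim2
  rw [integral_sub hi1 hi2] at h
  exact sub_eq_zero.1 h

lemma fockInner_self (f : ℂ → ℂ) : fockInner f f = (fockNormSq f : ℂ) := by
  rw [fockInner, fockNormSq, ← integral_complex_ofReal]
  refine integral_congr_ae (ae_of_all _ fun z => ?_)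
  simp [mul_conj, normSq_eq_norm_sq]

lemma fockInner_add_right {f g h : ℂ → ℂ} (hf : MemFock f) (hg : MemFock g) (hh : MemFock h) :
    fockInner f (fun z => g z + h z) = fockInner f g + fockInner f h := by
  rw [fockInner, fockInner, fockInner, ← integral_add (integrable_mul_conj_mul_fockWt hf hg)
    (integrable_mul_conj_mul_fockWt hf hh)]
  refine integral_congr_ae (ae_of_all _ fun z => ?_)
  simp only [map_add]
  ring

lemma deriv_eval (p : Polynomial ℂ) :
    deriv (fun z => p.eval z) = fun z => (Polynomial.derivative p).eval z :=
  funext fun _ => p.deriv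

/-- A polynomial of degree less than `N` is orthogonal to every element of the Fock space
that vanishes to order `N` at the origin. -/
lemma fockInner_eval_pow_mul_eq_zero (N : ℕ) {h : ℂ → ℂ} (hd : Differentiable ℂ h)
    {p : Polynomial ℂ} (hp : Polynomial.derivative^[N] p = 0)
    (hN : MemFock (fun z => z ^ N * h z)) :
    fockInner (fun z => p.eval z) (fun z => z ^ N * h z) = 0 := by
  induction N generalizing p with
  | zero =>
    obtain rfl : p = 0 := hp
    simp [fockInner]
  | succ N ih =>
    have he : (fun z => z ^ (N + 1) * h z) = fun z => z * (z ^ N * h z) := by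
      funext z; ring
    rw [he] at hN ⊢
    have hN' : MemFock (fun z => z ^ N * h z) :=
      memFock_of_memFock_mul ((differentiable_pow N).mul hd) hN
    have hq : MemFock (deriv fun z => p.eval z) := by
      rw [deriv_eval]; exact memFock_eval _
    rw [← fockInner_deriv_eq (memFock_eval p) hq hN' hN, deriv_eval]
    exact ih hp hN'

lemma differentiable_iterate_dslope {g : ℂ → ℂ} (hg : Differentiable ℂ g) (n : ℕ) :
    Differentiable ℂ ((Function.swap dslope 0)^[n] g) := by
  induction n with
  | zero => exact hg
  | succ n ih =>
    rw [Function.iterate_succ_apply', ← differentiableOn_univ]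
    exact (differentiableOn_dslope univ_mem).2 ih.differentiableOn

/-- The Taylor polynomial of `g` at `0` of degree less than `N`. -/
def fockTaylor (g : ℂ → ℂ) (N : ℕ) : Polynomial ℂ :=
  ∑ n ∈ Finset.range N, Polynomial.monomial n ((Function.swap dslope 0)^[n] g 0)

lemma eval_fockTaylor_add (g : ℂ → ℂ) (N : ℕ) (z : ℂ) :
    (fockTaylor g N).eval z + z ^ N * (Function.swap dslope 0)^[N] g z = g z := by
  induction N with
  | zero => simp [fockTaylor]
  | succ N ih =>
    have h := sub_smul_dslope ((Function.swap dslope 0)^[N] g) 0 z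
    rw [sub_zero, smul_eq_mul] at h
    rw [← ih, Function.iterate_succ_apply']
    simp only [fockTaylor, Finset.sum_range_succ, Polynomial.eval_add, Polynomial.eval_monomial,
      Function.swap]
    linear_combination z ^ N * h

lemma degree_fockTaylor_lt (g : ℂ → ℂ) (N : ℕ) : (fockTaylor g N).degree < N :=
  Polynomial.mem_degreeLT.1 <| Submodule.sum_mem _ fun n hn => Polynomial.mem_degreeLT.2 <|
    (Polynomial.degree_monomial_le _ _).trans_lt (by exact_mod_cast Finset.mem_range.1 hn)

lemma tendsto_eval_fockTaylor {g : ℂ → ℂ} (hg : Differentiable ℂ g) (z : ℂ) :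
    Tendsto (fun N => (fockTaylor g N).eval z) atTop (nhds (g z)) := by
  have hp := hg.hasFPowerSeriesOnBall 0 one_pos
  have hs := (hp.hasSum (y := z) (by simp)).tendsto_sum_nat
  rw [zero_add] at hs
  refine hs.congr fun N => ?_
  rw [fockTaylor, Polynomial.eval_finsetSum]
  refine Finset.sum_congr rfl fun n _ => ?_
  have h := hp.hasFPowerSeriesAt.has_fpower_series_iterate_dslope_fslope n
  have h0 := h.coeff_zero 1
  rw [← h0, Polynomial.eval_monomial, FormalMultilinearSeries.apply_eq_pow_smul_coeff, smul_eq_mul,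
    mul_comm]
  congr 1
  have := FormalMultilinearSeries.coeff_iterate_fslope (p := cauchyPowerSeries g 0 1) n 0
  rw [zero_add] at this
  exact this.symm

/-- A uniform bound on the norms of a pointwise convergent sequence in the Fock space gives
membership of an entire limit. -/
lemma memFock_of_tendsto {F : ℕ → ℂ → ℂ} {f : ℂ → ℂ} {K : ℝ} (hF : ∀ n, MemFock (F n))
    (hK : ∀ n, fockNormSq (F n) ≤ K) (hf : Differentiable ℂ f)
    (hlim : ∀ z, Tendsto (fun n => F n z) atTop (nhds (f z))) : MemFock f := by
  have hc : Continuous (fun z : ℂ => ‖f z‖ ^ 2 * fockWt z) :=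
    (hf.continuous.norm.pow 2).mul continuous_fockWt
  have hcF (n : ℕ) : Continuous (fun z : ℂ => ‖F n z‖ ^ 2 * fockWt z) :=
    ((hF n).1.continuous.norm.pow 2).mul continuous_fockWt
  have hnn (f : ℂ → ℂ) (z : ℂ) : 0 ≤ ‖f z‖ ^ 2 * fockWt z :=
    mul_nonneg (by positivity) (fockWt_pos z).le
  refine ⟨hf, hc.aestronglyMeasurable, ?_⟩
  rw [hasFiniteIntegral_iff_ofReal (ae_of_all _ (hnn f))]
  have hliminf (z : ℂ) : ENNReal.ofReal (‖f z‖ ^ 2 * fockWt z) =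
      liminf (fun n => ENNReal.ofReal (‖F n z‖ ^ 2 * fockWt z)) atTop :=
    (ENNReal.tendsto_ofReal (((hlim z).norm.pow 2).mul_const _)).liminf_eq.symm
  calc ∫⁻ z, ENNReal.ofReal (‖f z‖ ^ 2 * fockWt z)
      = ∫⁻ z, liminf (fun n => ENNReal.ofReal (‖F n z‖ ^ 2 * fockWt z)) atTop :=
        lintegral_congr hliminf
    _ ≤ liminf (fun n => ∫⁻ z, ENNReal.ofReal (‖F n z‖ ^ 2 * fockWt z)) atTop :=
        lintegral_liminf_le fun n => (hcF n).measurable.ennreal_ofReal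
    _ ≤ liminf (fun _ : ℕ => ENNReal.ofReal K) atTop := by
        refine liminf_le_liminf (Eventually.of_forall fun n => ?_)
        rw [← ofReal_integral_eq_lintegral_ofReal (hF n).2 (ae_of_all _ (hnn (F n)))]
        exact ENNReal.ofReal_le_ofReal (hK n)
    _ = ENNReal.ofReal K := liminf_const _
    _ < ⊤ := ENNReal.ofReal_lt_top

theorem memFock_mul_of_bounded {g : ℂ → ℂ} (hg : MemFock g) {C : ℝ}
    (hC : ∀ f : ℂ → ℂ, MemFock f → MemFock (deriv f) →
      ‖fockInner (deriv f) g‖ ≤ C * Real.sqrt (fockNormSq f)) :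
    MemFock (fun z => z * g z) := by
  have hmul (N : ℕ) : (fun z => z * (fockTaylor g N).eval z) =
      fun z => (Polynomial.X * fockTaylor g N).eval z := by simp
  have hF (N : ℕ) : MemFock (fun z => z * (fockTaylor g N).eval z) := by
    rw [hmul]; exact memFock_eval _
  refine memFock_of_tendsto (F := fun N z => z * (fockTaylor g N).eval z) (K := C ^ 2) hF
    (fun N => ?_) (differentiable_id.mul hg.1)
    (fun z => (tendsto_eval_fockTaylor hg.1 z).const_mul z)
  set P := fockTaylor g N with hP
  set R : ℂ → ℂ := fun z => z ^ N * (Function.swap dslope 0)^[N] g z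
  have hdF : MemFock (deriv fun z => z * P.eval z) := by
    rw [hmul, deriv_eval]; exact memFock_eval _
  have hsum : g = fun z => P.eval z + R z := funext fun z => (eval_fockTaylor_add g N z).symm
  have hRmem : MemFock R := by
    have : R = fun z => g z + (-1) * P.eval z := by
      funext z
      rw [hsum]
      ring
    rw [this]
    exact hg.add ((memFock_eval P).const_mul _)
  have horth : fockInner (deriv fun z => z * P.eval z) R = 0 := by
    rw [hmul, deriv_eval]
    refine fockInner_eval_pow_mul_eq_zero N (differentiable_iterate_dslope hg.1 N) ?_ hRmem
    rw [← Function.iterate_succ_apply]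
    refine Polynomial.iterate_derivative_eq_zero_of_degree_lt ?_
    rw [← hP]
    rcases eq_or_ne P 0 with h0 | h0
    · rw [h0, mul_zero, Polynomial.degree_zero]
      exact WithBot.bot_lt_coe _
    · rw [Polynomial.X_mul, Polynomial.degree_mul_X, Nat.cast_succ]
      have := degree_fockTaylor_lt g N
      rw [← hP, Polynomial.degree_eq_natDegree h0] at this
      rw [Polynomial.degree_eq_natDegree h0]
      exact_mod_cast Nat.succ_lt_succ (by exact_mod_cast this)
  have hnorm : fockInner (deriv fun z => z * P.eval z) g =
      (fockNormSq (fun z => z * P.eval z) : ℂ) := by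
    conv_lhs => rw [hsum]
    rw [fockInner_add_right hdF (memFock_eval P) hRmem, horth, add_zero,
      fockInner_deriv_eq (hF N) hdF (memFock_eval P) (hF N), fockInner_self]
  have hb := hC _ (hF N) hdF
  have hnn := fockNormSq_nonneg (fun z => z * P.eval z)
  rw [hnorm, norm_real, Real.norm_of_nonneg hnn] at hb
  have hsq := Real.sq_sqrt hnn
  nlinarith [sq_nonneg (C - Real.sqrt (fockNormSq (fun z => z * P.eval z)))]

/-- The adjoint of the annihilation operator `a(f) = f'` (with domain
`{f ∈ A² : f' ∈ A²}`) has domain `{g ∈ A² : z g ∈ A²}` and acts as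
multiplication by `z`.  The domain of the adjoint is characterized by
continuity of `f ↦ (a f, g)` on `dom a`, and `(f', g) = (f, z g)`. -/
theorem stmt3 :
    -- characterization of the domain of the adjoint
    (∀ g : ℂ → ℂ, MemFock g →
      ((∃ C : ℝ, ∀ f : ℂ → ℂ, MemFock f → MemFock (deriv f) →
          ‖fockInner (deriv f) g‖ ≤ C * Real.sqrt (fockNormSq f)) ↔
        MemFock (fun z => z * g z))) ∧
    -- the adjoint acts by multiplication by z
    (∀ f g : ℂ → ℂ, MemFock f → MemFock (deriv f) → MemFock g →
      MemFock (fun z => z * g z) →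
      fockInner (deriv f) g = fockInner f (fun z => z * g z)) := by
  refine ⟨fun g hg => ⟨fun ⟨C, hC⟩ => memFock_mul_of_bounded hg hC, fun hzg =>
    ⟨Real.sqrt (fockNormSq fun z => z * g z), fun f hf hf' => ?_⟩⟩,
    fun f g hf hf' hg hzg => fockInner_deriv_eq hf hf' hg hzg⟩
  rw [fockInner_deriv_eq hf hf' hg hzg]
  exact norm_fockInner_le hf hzg
end
end

section
/- Let 1 ≤ p ≤ n−1 and let u = Σ'_{|J|=p} u_J dz_J (sum over increasing multiindices J of length p) be a (p,0)-form with coefficients in the Fock space A²(ℂⁿ, e^{-|z|²}), with u ∈ dom(∂) ∩ dom(∂*). Then ‖∂u‖² + ‖∂*u‖² = Σ'_{|J|=p} Σ_{j=1}^n ‖∂u_J/∂z_j‖² + p Σ'_{|J|=p} ∫_{ℂⁿ} |u_J|² e^{-|z|²} dλ. -/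
open MeasureTheory Filter Complex Finset

noncomputable section

/-- Points of `ℂⁿ`. -/
abbrev Cn (n : ℕ) := Fin n → ℂ

/-- A form with coefficients indexed by subsets of `{1,…,n}`; a `(p,0)`-form
`Σ'_{|J|=p} u_J dz_J` is such a family supported on sets of cardinality `p`. -/
abbrev FormC (n : ℕ) := Finset (Fin n) → Cn n → ℂ

/-- The Fock weight `e^{-|z|²}` on `ℂⁿ`. -/
def fWt {n : ℕ} (z : Cn n) : ℝ := Real.exp (-(∑ j, ‖z j‖ ^ 2))

/-- Squared Fock norm `‖f‖² = ∫ |f|² e^{-|z|²} dλ`. -/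
def fNormSq {n : ℕ} (f : Cn n → ℂ) : ℝ := ∫ z : Cn n, ‖f z‖ ^ 2 * fWt z

/-- Fock inner product `(f,g) = ∫ f ḡ e^{-|z|²} dλ`. -/
def fInner {n : ℕ} (f g : Cn n → ℂ) : ℂ :=
  ∫ z : Cn n, f z * (starRingEnd ℂ) (g z) * fWt z

/-- Membership in the Fock space `A²(ℂⁿ, e^{-|z|²})`. -/
def MemF {n : ℕ} (f : Cn n → ℂ) : Prop :=
  Differentiable ℂ f ∧ Integrable (fun z : Cn n => ‖f z‖ ^ 2 * fWt z)

/-- The holomorphic partial derivative `∂f/∂z_j`. -/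
def pdz {n : ℕ} (j : Fin n) (f : Cn n → ℂ) : Cn n → ℂ :=
  fun z => fderiv ℂ f z (Pi.single j 1)

/-- The sign `(-1)^{#{i ∈ J : i < j}}` arising from `dz_j ∧ dz_J`. -/
def sgn {n : ℕ} (j : Fin n) (J : Finset (Fin n)) : ℂ :=
  (-1 : ℂ) ^ (J.filter (fun i => i < j)).card

/-- The operator `∂`: `(∂u)_L = Σ_{j ∈ L} ± ∂u_{L\{j}}/∂z_j`, i.e.
`∂u = Σ'_J Σ_j (∂u_J/∂z_j) dz_j ∧ dz_J`. -/
def dOp {n : ℕ} (u : FormC n) : FormC n :=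
  fun L z => ∑ j ∈ L, sgn j (L.erase j) * pdz j (u (L.erase j)) z

/-- The adjoint `∂*`: `(∂*u)_K = Σ_{j ∉ K} ± z_j u_{K ∪ {j}}`, i.e.
`∂*u = Σ'_K Σ_j z_j u_{jK} dz_K` on the Fock space. -/
def dStarOp {n : ℕ} (u : FormC n) : FormC n :=
  fun K z => ∑ j ∈ Kᶜ, sgn j K * (z j * u (insert j K) z)

/-- The complex Laplacian `□̃ = ∂*∂ + ∂∂*`. -/
def boxOp {n : ℕ} (u : FormC n) : FormC n :=
  fun J z => dStarOp (dOp u) J z + dOp (dStarOp u) J z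

/-- All coefficients belong to the Fock space. -/
def MemA2 {n : ℕ} (u : FormC n) : Prop := ∀ J, MemF (u J)

/-- `u` is a `(p,0)`-form: only coefficients with `|J| = p` may be nonzero. -/
def IsDeg {n : ℕ} (p : ℕ) (u : FormC n) : Prop :=
  ∀ J : Finset (Fin n), J.card ≠ p → u J = 0

/-- Squared norm of a form: `Σ'_J ‖u_J‖²`. -/
def formNormSq {n : ℕ} (u : FormC n) : ℝ := ∑ J : Finset (Fin n), fNormSq (u J)

/-- Inner product of forms: `Σ'_J (u_J, v_J)`. -/
def formInner {n : ℕ} (u v : FormC n) : ℂ := ∑ J : Finset (Fin n), fInner (u J) (v J)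

/-- `u ∈ dom ∂`. -/
def domD {n : ℕ} (u : FormC n) : Prop := MemA2 u ∧ MemA2 (dOp u)

/-- `u ∈ dom ∂*`. -/
def domDs {n : ℕ} (u : FormC n) : Prop := MemA2 u ∧ MemA2 (dStarOp u)

/-- `u ∈ dom □̃`: `u ∈ dom ∂ ∩ dom ∂*`, `∂u ∈ dom ∂*` and `∂*u ∈ dom ∂`. -/
def domBox {n : ℕ} (u : FormC n) : Prop :=
  domD u ∧ domDs u ∧ domDs (dOp u) ∧ domD (dStarOp u)

theorem pdz_eq_circle_average {n : ℕ} {f : Cn n → ℂ} (hf : Differentiable ℂ f) (k : Fin n)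
    (z : Cn n) :
    pdz k f z = (2 * Real.pi : ℂ)⁻¹ * ∫ θ in (0 : ℝ)..2 * Real.pi,
      (circleMap 0 1 θ)⁻¹ * f (z + Pi.single k (circleMap 0 1 θ)) := by
  set g : ℂ → ℂ := fun ζ => f (z + ζ • Pi.single k (1 : ℂ)) with hg
  have hgd : Differentiable ℂ g := by fun_prop
  have hder : deriv g 0 = pdz k f z := by
    have h := ((hf z).hasFDerivAt.hasLineDerivAt (Pi.single k (1 : ℂ))).deriv
    simpa [lineDeriv, pdz] using h
  have hcauchy := Complex.differentiable_on_off_countable_deriv_eq_smul_circleIntegral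
    (c := 0) (f := g) one_pos Set.countable_empty hgd.continuous.continuousOn
    fun w _ => hgd w
  have hpi : (Real.pi : ℂ) ≠ 0 := by exact_mod_cast Real.pi_ne_zero
  rw [eq_comm, ← eq_inv_smul_iff₀ (by simp [hpi])] at hcauchy
  rw [← hder, hcauchy, circleIntegral,
    ← intervalIntegral.integral_const_mul, ← intervalIntegral.integral_smul]
  refine intervalIntegral.integral_congr fun θ _ => ?_
  have h0 : circleMap 0 1 θ ≠ 0 := circleMap_ne_center one_ne_zero
  have hsm : circleMap 0 1 θ • Pi.single k (1 : ℂ) = (Pi.single k (circleMap 0 1 θ) : Cn n) := by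
    rw [← Pi.single_smul]; simp
  simp only [hg, deriv_circleMap, sub_zero, smul_eq_mul, hsm]
  field_simp

theorem norm_single_circleMap {n : ℕ} (k : Fin n) (θ : ℝ) :
    ‖(Pi.single k (circleMap 0 1 θ) : Cn n)‖ = 1 := by
  rw [Pi.norm_single]; simp

theorem continuous_single_circleMap {n : ℕ} (k : Fin n) :
    Continuous fun θ : ℝ => (Pi.single k (circleMap 0 1 θ) : Cn n) :=
  (continuous_single (A := fun _ : Fin n => ℂ) k).comp (continuous_circleMap 0 1)

theorem differentiable_integral_mul_comp_add {E : Type*} [NormedAddCommGroup E] [NormedSpace ℂ E]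
    [FiniteDimensional ℂ E] {f : E → ℂ} (hf : Differentiable ℂ f) {c : ℝ → ℂ} {a : ℝ → E}
    (hc : Continuous c) (ha : Continuous a) (hc1 : ∀ θ, ‖c θ‖ = 1) (ha1 : ∀ θ, ‖a θ‖ = 1)
    (T : ℝ) : Differentiable ℂ fun z => ∫ θ in (0 : ℝ)..T, c θ * f (z + a θ) := by
  intro z₀
  have : ProperSpace E := FiniteDimensional.proper ℂ E
  let _ : MeasurableSpace E := borel E
  have : BorelSpace E := ⟨rfl⟩
  obtain ⟨M, hM⟩ := (isCompact_closedBall z₀ (3 : ℝ)).exists_bound_of_continuousOn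
    hf.continuous.continuousOn
  have hbd : ∀ w ∈ Metric.closedBall z₀ 2, ‖fderiv ℂ f w‖ ≤ (M + M) / 1 := by
    intro w hw
    have hsub : ∀ y ∈ Metric.ball w 1, ‖f y‖ ≤ M := fun y hy => by
      refine hM y ?_
      rw [Metric.mem_closedBall] at hw ⊢
      rw [Metric.mem_ball] at hy
      linarith [dist_triangle y w z₀]
    refine Complex.norm_fderiv_le_div_of_mapsTo_ball hf.differentiableOn (fun y hy => ?_) one_pos
    rw [Metric.mem_closedBall, dist_eq_norm]
    exact (norm_sub_le _ _).trans
      (add_le_add (hsub y hy) (hsub w (Metric.mem_ball_self one_pos)))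
  have hcF : ∀ z : E, Continuous fun θ : ℝ => c θ * f (z + a θ) := fun z =>
    hc.mul (hf.continuous.comp (continuous_const.add ha))
  have hmeas : AEStronglyMeasurable (fun θ => c θ • fderiv ℂ f (z₀ + a θ))
      (volume.restrict (Set.uIoc 0 T)) := by
    refine hc.aestronglyMeasurable.smul ?_
    exact ((measurable_fderiv ℂ f).comp (continuous_const.add ha).measurable).aestronglyMeasurable
  refine (intervalIntegral.hasFDerivAt_integral_of_dominated_of_fderiv_le
    (bound := fun _ => (M + M) / 1)
    (F' := fun z θ => c θ • fderiv ℂ f (z + a θ))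
    (Metric.ball_mem_nhds z₀ one_pos)
    (Eventually.of_forall fun z => (hcF z).aestronglyMeasurable)
    ((hcF z₀).intervalIntegrable _ _) hmeas ?_ intervalIntegrable_const ?_).differentiableAt
  · refine Eventually.of_forall fun θ _ z hz => ?_
    rw [norm_smul, hc1, one_mul]
    refine hbd _ ?_
    rw [Metric.mem_ball, dist_eq_norm] at hz
    rw [Metric.mem_closedBall, dist_eq_norm, add_sub_right_comm]
    refine (norm_add_le _ _).trans ?_
    rw [ha1]
    linarith
  · refine Eventually.of_forall fun θ _ z _ => ?_
    exact ((hasFDerivAt_comp_add_right _).2 (hf (z + a θ)).hasFDerivAt).const_mul _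

theorem differentiable_pdz {n : ℕ} {f : Cn n → ℂ} (hf : Differentiable ℂ f) (k : Fin n) :
    Differentiable ℂ (pdz k f) := by
  rw [funext (pdz_eq_circle_average hf k)]
  exact (differentiable_integral_mul_comp_add hf
    ((continuous_circleMap 0 1).inv₀ fun θ => circleMap_ne_center one_ne_zero)
    (continuous_single_circleMap k) (by simp) (norm_single_circleMap k) _).const_mul _

/-- The Gaussian weight `e^{-t|z|²}` on `ℂⁿ`. -/
def gWt {n : ℕ} (t : ℝ) (z : Cn n) : ℝ := Real.exp (-(t * ∑ j, ‖z j‖ ^ 2))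

/-- Entire functions that are square integrable against `e^{-t|z|²}` for every `t > 1`. -/
def MemFPlus {n : ℕ} (f : Cn n → ℂ) : Prop :=
  Differentiable ℂ f ∧ ∀ t > 1, Integrable fun z : Cn n => ‖f z‖ ^ 2 * gWt t z

theorem fWt_eq_gWt_one {n : ℕ} (z : Cn n) : fWt z = gWt 1 z := by simp [fWt, gWt]

theorem gWt_pos {n : ℕ} (t : ℝ) (z : Cn n) : 0 < gWt t z := Real.exp_pos _

theorem gWt_antitone {n : ℕ} (z : Cn n) : Antitone fun t => gWt t z := fun s t h => by
  refine Real.exp_le_exp.2 (neg_le_neg ?_)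
  exact mul_le_mul_of_nonneg_right h (Finset.sum_nonneg fun j _ => by positivity)

theorem continuous_gWt {n : ℕ} : Continuous fun p : ℝ × Cn n => gWt p.1 p.2 := by
  unfold gWt; fun_prop

theorem continuous_gWt_right {n : ℕ} (t : ℝ) : Continuous fun z : Cn n => gWt t z := by
  unfold gWt; fun_prop

theorem integrable_normSq_mul_gWt_of_le {n : ℕ} {f : Cn n → ℂ} (hf : Continuous f) {s t C : ℝ}
    {g : Cn n → ℂ} (hg : Integrable fun z : Cn n => ‖g z‖ ^ 2 * gWt s z)
    (h : ∀ z, ‖f z‖ ^ 2 * gWt t z ≤ C * (‖g z‖ ^ 2 * gWt s z)) :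
    Integrable fun z : Cn n => ‖f z‖ ^ 2 * gWt t z := by
  refine (hg.const_mul C).mono'
    ((hf.norm.pow 2).mul (continuous_gWt_right t)).aestronglyMeasurable
    (Eventually.of_forall fun z => ?_)
  rw [Real.norm_of_nonneg (mul_nonneg (by positivity) (gWt_pos t z).le)]
  exact h z

theorem MemF.memFPlus {n : ℕ} {f : Cn n → ℂ} (hf : MemF f) : MemFPlus f := by
  refine ⟨hf.1, fun t ht => ?_⟩
  have h2 := hf.2
  simp only [fWt_eq_gWt_one] at h2
  refine integrable_normSq_mul_gWt_of_le hf.1.continuous (C := 1) h2 fun z => ?_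
  rw [one_mul]
  exact mul_le_mul_of_nonneg_left (gWt_antitone z ht.le) (by positivity)

theorem MemFPlus.coord_mul {n : ℕ} {f : Cn n → ℂ} (hf : MemFPlus f) (j : Fin n) :
    MemFPlus fun z => z j * f z := by
  have hd : Differentiable ℂ fun z : Cn n => z j * f z := by
    have := hf.1
    fun_prop
  refine ⟨hd, fun t ht => ?_⟩
  obtain ⟨s, hs1, hst⟩ := exists_between ht
  refine integrable_normSq_mul_gWt_of_le hd.continuous (C := (t - s)⁻¹) (hf.2 s hs1) fun z => ?_
  have hpos : 0 < t - s := sub_pos.2 hst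
  have hle : ‖z j‖ ^ 2 ≤ ∑ i, ‖z i‖ ^ 2 :=
    Finset.single_le_sum (f := fun i => ‖z i‖ ^ 2) (fun i _ => by positivity) (Finset.mem_univ j)
  have hkey : ‖z j‖ ^ 2 * gWt t z ≤ (t - s)⁻¹ * gWt s z := by
    have hexp : gWt s z = Real.exp ((t - s) * ∑ i, ‖z i‖ ^ 2) * gWt t z := by
      rw [gWt, gWt, ← Real.exp_add]; congr 1; ring
    rw [hexp, ← mul_assoc]
    refine mul_le_mul_of_nonneg_right ?_ (gWt_pos t z).le
    rw [inv_mul_eq_div, le_div_iff₀ hpos]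
    have := Real.add_one_le_exp ((t - s) * ∑ i, ‖z i‖ ^ 2)
    nlinarith
  calc ‖z j * f z‖ ^ 2 * gWt t z = ‖f z‖ ^ 2 * (‖z j‖ ^ 2 * gWt t z) := by
        rw [norm_mul]; ring
    _ ≤ ‖f z‖ ^ 2 * ((t - s)⁻¹ * gWt s z) := mul_le_mul_of_nonneg_left hkey (by positivity)
    _ = _ := by ring

theorem gWt_sub_single_le {n : ℕ} {s t : ℝ} (hs : 0 < s) (hst : s < t) (k : Fin n) {a : ℂ}
    (ha : ‖a‖ = 1) (z : Cn n) :
    gWt t (z - Pi.single k a) ≤ Real.exp (s * t / (t - s)) * gWt s z := by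
  rw [gWt, gWt, ← Real.exp_add, Real.exp_le_exp]
  have hpos : 0 < t - s := sub_pos.2 hst
  have hsum : ∀ w : Cn n, ∑ j, ‖w j‖ ^ 2 = ‖w k‖ ^ 2 + ∑ j ∈ Finset.univ.erase k, ‖w j‖ ^ 2 :=
    fun w => (Finset.add_sum_erase _ _ (Finset.mem_univ k)).symm
  have hrest : ∑ j ∈ Finset.univ.erase k, ‖(z - Pi.single k a : Cn n) j‖ ^ 2
      = ∑ j ∈ Finset.univ.erase k, ‖z j‖ ^ 2 :=
    Finset.sum_congr rfl fun j hj => by simp [Finset.ne_of_mem_erase hj]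
  rw [hsum, hsum z, hrest]
  set R := ∑ j ∈ Finset.univ.erase k, ‖z j‖ ^ 2
  have hR : 0 ≤ R := Finset.sum_nonneg fun j _ => by positivity
  set x := ‖(z - Pi.single k a : Cn n) k‖ with hx
  have hzx : ‖z k‖ ≤ x + 1 := by
    have : z k = (z - Pi.single k a : Cn n) k + a := by simp
    rw [this, ← ha]
    exact norm_add_le _ _
  have hx0 : 0 ≤ x := norm_nonneg _
  have hz2 : ‖z k‖ ^ 2 ≤ (x + 1) ^ 2 := pow_le_pow_left₀ (norm_nonneg _) hzx 2
  have hmain : s * (x + 1) ^ 2 ≤ s * t / (t - s) + t * x ^ 2 := by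
    have : s * t / (t - s) + t * x ^ 2 - s * (x + 1) ^ 2 = ((t - s) * x - s) ^ 2 / (t - s) := by
      field_simp
      ring
    have h2 : 0 ≤ ((t - s) * x - s) ^ 2 / (t - s) := by positivity
    linarith
  nlinarith

theorem normSq_pdz_le {n : ℕ} {f : Cn n → ℂ} (hf : Differentiable ℂ f) (k : Fin n) (z : Cn n) :
    ‖pdz k f z‖ ^ 2 ≤ (2 * Real.pi)⁻¹ * ∫ θ in (0 : ℝ)..2 * Real.pi,
      ‖f (z + Pi.single k (circleMap 0 1 θ))‖ ^ 2 := by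
  have hpi := Real.two_pi_pos
  set X : ℝ → ℝ := fun θ => ‖f (z + Pi.single k (circleMap 0 1 θ))‖ with hX
  have hXc : Continuous X :=
    (hf.continuous.comp (continuous_const.add (continuous_single_circleMap k))).norm
  set m := ∫ θ in (0 : ℝ)..2 * Real.pi, X θ with hm
  have hle : ‖pdz k f z‖ ≤ (2 * Real.pi)⁻¹ * m := by
    rw [pdz_eq_circle_average hf, norm_mul]
    refine mul_le_mul (by simp [abs_of_pos Real.pi_pos]) ?_ (norm_nonneg _) (by positivity)
    refine (intervalIntegral.norm_integral_le_integral_norm hpi.le).trans_eq ?_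
    refine intervalIntegral.integral_congr fun θ _ => ?_
    simp [hX]
  have hvar : 0 ≤ ∫ θ in (0 : ℝ)..2 * Real.pi, (X θ - (2 * Real.pi)⁻¹ * m) ^ 2 :=
    intervalIntegral.integral_nonneg hpi.le fun θ _ => sq_nonneg _
  have hexpand : ∫ θ in (0 : ℝ)..2 * Real.pi, (X θ - (2 * Real.pi)⁻¹ * m) ^ 2
      = (∫ θ in (0 : ℝ)..2 * Real.pi, X θ ^ 2) - (2 * Real.pi)⁻¹ * m ^ 2 := by
    have : ∀ θ, (X θ - (2 * Real.pi)⁻¹ * m) ^ 2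
        = X θ ^ 2 - 2 * ((2 * Real.pi)⁻¹ * m) * X θ + ((2 * Real.pi)⁻¹ * m) ^ 2 := fun θ => by ring
    simp only [this]
    rw [intervalIntegral.integral_add, intervalIntegral.integral_sub,
      intervalIntegral.integral_const_mul, intervalIntegral.integral_const, ← hm, smul_eq_mul]
    · field_simp
      ring
    all_goals exact Continuous.intervalIntegrable (by fun_prop) _ _
  calc ‖pdz k f z‖ ^ 2 ≤ ((2 * Real.pi)⁻¹ * m) ^ 2 := pow_le_pow_left₀ (norm_nonneg _) hle 2
    _ = (2 * Real.pi)⁻¹ * ((2 * Real.pi)⁻¹ * m ^ 2) := by ring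
    _ ≤ _ := mul_le_mul_of_nonneg_left (by linarith) (by positivity)

theorem MemFPlus.pdz {n : ℕ} {f : Cn n → ℂ} (hf : MemFPlus f) (k : Fin n) :
    MemFPlus (pdz k f) := by
  have hd := differentiable_pdz hf.1 k
  refine ⟨hd, fun t ht => ?_⟩
  obtain ⟨s, hs1, hst⟩ := exists_between ht
  set a : ℝ → Cn n := fun θ => Pi.single k (circleMap 0 1 θ) with ha
  have hac : Continuous a := continuous_single_circleMap k
  have hfc := hf.1.continuous
  set C := Real.exp (s * t / (t - s))
  set F : ℝ × Cn n → ℝ := fun p => ‖f (p.2 + a p.1)‖ ^ 2 * gWt t p.2 with hF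
  have hFc : Continuous F := by
    have := (continuous_gWt_right (n := n) t).comp (continuous_snd (X := ℝ))
    have h2 : Continuous fun p : ℝ × Cn n => ‖f (p.2 + a p.1)‖ ^ 2 :=
      ((hfc.comp (continuous_snd.add (hac.comp continuous_fst))).norm).pow 2
    exact h2.mul this
  have hF0 : ∀ p, 0 ≤ F p := fun p => mul_nonneg (by positivity) (gWt_pos t _).le
  have hint : ∀ θ, Integrable (fun z => C * (‖f (z + a θ)‖ ^ 2 * gWt s (z + a θ))) := fun θ =>
    ((hf.2 s hs1).comp_add_right (a θ)).const_mul C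
  have hFle : ∀ θ z, F (θ, z) ≤ C * (‖f (z + a θ)‖ ^ 2 * gWt s (z + a θ)) := fun θ z => by
    have h := gWt_sub_single_le (zero_lt_one.trans hs1) hst k (a := circleMap 0 1 θ) (by simp)
      (z + a θ)
    rw [show z + a θ - Pi.single k (circleMap 0 1 θ) = z from add_sub_cancel_right _ _] at h
    calc F (θ, z) ≤ ‖f (z + a θ)‖ ^ 2 * (C * gWt s (z + a θ)) :=
          mul_le_mul_of_nonneg_left h (by positivity)
      _ = _ := by ring
  have hFint : ∀ θ, Integrable fun z => F (θ, z) := fun θ =>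
    (hint θ).mono' (hFc.comp (Continuous.prodMk_right θ)).aestronglyMeasurable
      (Eventually.of_forall fun z => by
        rw [Real.norm_of_nonneg (hF0 _)]
        exact hFle θ z)
  have hprod : Integrable F ((volume.restrict (Set.Ioc 0 (2 * Real.pi))).prod volume) := by
    rw [integrable_prod_iff hFc.aestronglyMeasurable]
    refine ⟨Eventually.of_forall hFint, ?_⟩
    refine Integrable.mono' (g := fun _ => C * ∫ z : Cn n, ‖f z‖ ^ 2 * gWt s z)
      (integrable_const _) hFc.aestronglyMeasurable.norm.integral_prod_right'
      (Eventually.of_forall fun θ => ?_)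
    rw [Real.norm_of_nonneg (integral_nonneg fun z => norm_nonneg _)]
    simp only [Real.norm_of_nonneg (hF0 _)]
    refine (integral_mono (hFint θ) (hint θ) (hFle θ)).trans_eq ?_
    rw [integral_const_mul, integral_add_right_eq_self fun z : Cn n => ‖f z‖ ^ 2 * gWt s z]
  refine (hprod.integral_prod_right.const_mul (2 * Real.pi)⁻¹).mono'
    ((hd.continuous.norm.pow 2).mul (continuous_gWt_right t)).aestronglyMeasurable
    (Eventually.of_forall fun z => ?_)
  rw [Real.norm_of_nonneg (mul_nonneg (by positivity) (gWt_pos t z).le)]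
  simp only [hF]
  rw [integral_mul_const, ← mul_assoc]
  refine mul_le_mul_of_nonneg_right ?_ (gWt_pos t z).le
  rw [← intervalIntegral.integral_of_le Real.two_pi_pos.le]
  exact normSq_pdz_le hf.1 k z

/-- The inner product `∫ f ḡ e^{-t|z|²} dλ`. -/
def gInner {n : ℕ} (t : ℝ) (f g : Cn n → ℂ) : ℂ :=
  ∫ z : Cn n, f z * (starRingEnd ℂ) (g z) * gWt t z

theorem MemFPlus.integrable_mul_conj {n : ℕ} {f g : Cn n → ℂ} (hf : MemFPlus f)
    (hg : MemFPlus g) {t : ℝ} (ht : 1 < t) :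
    Integrable fun z : Cn n => f z * (starRingEnd ℂ) (g z) * gWt t z := by
  refine ((hf.2 t ht).add (hg.2 t ht)).mono' ?_ (Eventually.of_forall fun z => ?_)
  · exact ((hf.1.continuous.mul (Complex.continuous_conj.comp hg.1.continuous)).mul
      (Complex.continuous_ofReal.comp (continuous_gWt_right t))).aestronglyMeasurable
  · have hw := gWt_pos t z
    rw [norm_mul, norm_mul, RCLike.norm_conj, Complex.norm_real, Real.norm_of_nonneg hw.le]
    simp only [Pi.add_apply]
    rw [← add_mul]
    exact mul_le_mul_of_nonneg_right
      (by nlinarith [sq_nonneg (‖f z‖ - ‖g z‖), sq_nonneg ‖f z‖, sq_nonneg ‖g z‖]) hw.le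

theorem fderiv_apply_single {n : ℕ} (f : Cn n → ℂ) (k : Fin n) (c : ℂ) (z : Cn n) :
    fderiv ℂ f z (Pi.single k c) = c * pdz k f z := by
  have h : (Pi.single k c : Cn n) = c • Pi.single k (1 : ℂ) := by
    rw [← Pi.single_smul]; simp
  rw [h, map_smul, smul_eq_mul, pdz]

theorem hasLineDerivAt_gWt {n : ℕ} (t : ℝ) (k : Fin n) (c : ℂ) (z : Cn n) :
    HasLineDerivAt ℝ (fun z : Cn n => (gWt t z : ℂ))
      (-(t * ((starRingEnd ℂ) c * z k + c * (starRingEnd ℂ) (z k))) * gWt t z) z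
      (Pi.single k c) := by
  set R : ℝ := (starRingEnd ℂ c * z k).re with hR
  have hpoly : ∀ s : ℝ, ∑ j, ‖(z + s • (Pi.single k c : Cn n)) j‖ ^ 2
      = ∑ j, ‖z j‖ ^ 2 + (2 * s * R + s ^ 2 * ‖c‖ ^ 2) := by
    intro s
    rw [← Finset.add_sum_erase _ _ (Finset.mem_univ k),
      ← Finset.add_sum_erase _ (fun j => ‖z j‖ ^ 2) (Finset.mem_univ k)]
    have hrest : ∑ j ∈ Finset.univ.erase k, ‖(z + s • (Pi.single k c : Cn n)) j‖ ^ 2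
        = ∑ j ∈ Finset.univ.erase k, ‖z j‖ ^ 2 :=
      Finset.sum_congr rfl fun j hj => by simp [Finset.ne_of_mem_erase hj]
    rw [hrest, hR]
    simp only [Pi.add_apply, Pi.smul_apply, Pi.single_eq_same, ← Complex.normSq_eq_norm_sq,
      Complex.normSq_apply, Complex.add_re, Complex.add_im, Complex.real_smul, Complex.mul_re,
      Complex.mul_im, Complex.ofReal_re, Complex.ofReal_im, Complex.conj_re, Complex.conj_im]
    ring
  have hreal : HasDerivAt (fun s : ℝ => gWt t (z + s • (Pi.single k c : Cn n)))
      (-(t * (2 * R)) * gWt t z) 0 := by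
    simp only [gWt, hpoly]
    have h1 : HasDerivAt (fun s : ℝ => 2 * s * R + s ^ 2 * ‖c‖ ^ 2) (2 * R) 0 := by
      have := (((hasDerivAt_id (0 : ℝ)).const_mul 2).mul_const R).add
        (((hasDerivAt_id (0 : ℝ)).pow 2).mul_const (‖c‖ ^ 2))
      simpa using! this
    have h2 := ((h1.const_add (∑ j, ‖z j‖ ^ 2)).const_mul t).neg.exp
    simpa [mul_comm] using! h2
  have h2R : (starRingEnd ℂ) c * z k + c * (starRingEnd ℂ) (z k) = ((2 * R : ℝ) : ℂ) := by
    rw [hR, ← Complex.add_conj, map_mul, Complex.conj_conj]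
  rw [h2R]
  have := hreal.ofReal_comp
  simpa [HasLineDerivAt] using! this

theorem gInner_line_parts {n : ℕ} {f g : Cn n → ℂ} (hf : MemFPlus f) (hg : MemFPlus g)
    {t : ℝ} (ht : 1 < t) (k : Fin n) (c : ℂ) :
    t * ((starRingEnd ℂ) c * gInner t (fun z => z k * f z) g
        + c * gInner t f (fun z => z k * g z))
      = c * gInner t (pdz k f) g + (starRingEnd ℂ) c * gInner t f (pdz k g) := by
  have i0 := hf.integrable_mul_conj hg ht
  have i1 := (hf.coord_mul k).integrable_mul_conj hg ht
  have i2 := hf.integrable_mul_conj (hg.coord_mul k) ht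
  have i3 := (hf.pdz k).integrable_mul_conj hg ht
  have i4 := hf.integrable_mul_conj (hg.pdz k) ht
  have hw' : ∀ z : Cn n, f z * (starRingEnd ℂ) (g z)
        * (-(t * ((starRingEnd ℂ) c * z k + c * (starRingEnd ℂ) (z k))) * gWt t z)
      = -(t * ((starRingEnd ℂ) c * (z k * f z * (starRingEnd ℂ) (g z) * gWt t z)
        + c * (f z * (starRingEnd ℂ) (z k * g z) * gWt t z))) := fun z => by
    rw [map_mul]; ring
  have hfg' : ∀ z : Cn n, (c * pdz k f z * (starRingEnd ℂ) (g z)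
        + f z * (starRingEnd ℂ) (c * pdz k g z)) * gWt t z
      = c * (pdz k f z * (starRingEnd ℂ) (g z) * gWt t z)
        + (starRingEnd ℂ) c * (f z * (starRingEnd ℂ) (pdz k g z) * gWt t z) := fun z => by
    rw [map_mul]; ring
  have hparts := integral_bilinear_hasLineDerivAt_right_eq_neg_left_of_integrable
    (μ := (volume : Measure (Cn n)))
    (B := ContinuousLinearMap.mul ℝ ℂ) (v := Pi.single k c)
    (f := fun z => f z * (starRingEnd ℂ) (g z))
    (f' := fun z => c * pdz k f z * (starRingEnd ℂ) (g z)
      + f z * (starRingEnd ℂ) (c * pdz k g z))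
    (g := fun z => (gWt t z : ℂ))
    (g' := fun z => -(t * ((starRingEnd ℂ) c * z k + c * (starRingEnd ℂ) (z k))) * gWt t z)
    (by
      simp only [ContinuousLinearMap.mul_apply', hfg']
      exact (i3.const_mul _).add (i4.const_mul _))
    (by
      simp only [ContinuousLinearMap.mul_apply', hw']
      exact (((i1.const_mul _).add (i2.const_mul _)).const_mul _).neg)
    (by simpa only [ContinuousLinearMap.mul_apply'] using i0)
    (fun z _ => by
      have hF := ((hf.1 z).hasFDerivAt.restrictScalars ℝ).hasLineDerivAt (Pi.single k c)
      have hG := ((hg.1 z).hasFDerivAt.restrictScalars ℝ).hasLineDerivAt (Pi.single k c)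
      have h := HasDerivAt.mul hF (HasDerivAt.star hG)
      simpa [HasLineDerivAt, fderiv_apply_single] using! h)
    (fun z _ => hasLineDerivAt_gWt t k c z)
  simp only [ContinuousLinearMap.mul_apply', hw', hfg'] at hparts
  rw [integral_neg, neg_inj, integral_const_mul,
    integral_add (i1.const_mul _) (i2.const_mul _), integral_add (i3.const_mul _) (i4.const_mul _),
    integral_const_mul, integral_const_mul, integral_const_mul, integral_const_mul] at hparts
  exact hparts

theorem gInner_pdz_left {n : ℕ} {f g : Cn n → ℂ} (hf : MemFPlus f) (hg : MemFPlus g)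
    {t : ℝ} (ht : 1 < t) (k : Fin n) :
    gInner t (pdz k f) g = t * gInner t f (fun z => z k * g z) := by
  have h1 := gInner_line_parts hf hg ht k 1
  have hI := gInner_line_parts hf hg ht k Complex.I
  simp only [map_one, one_mul, Complex.conj_I] at h1 hI
  linear_combination -(1 / 2 : ℂ) * h1 + (Complex.I / 2) * hI
    - (1 / 2) * (t * gInner t f (fun z => z k * g z) - t * gInner t (fun z => z k * f z) g
      - gInner t (pdz k f) g + gInner t f (pdz k g)) * Complex.I_sq

theorem gInner_conj {n : ℕ} (t : ℝ) (f g : Cn n → ℂ) :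
    (starRingEnd ℂ) (gInner t f g) = gInner t g f := by
  rw [gInner, gInner, ← integral_conj]
  congr 1
  ext z
  simp only [map_mul, Complex.conj_conj, Complex.conj_ofReal]
  ring

theorem pdz_coord_mul {n : ℕ} {f : Cn n → ℂ} (hf : Differentiable ℂ f) (j k : Fin n) :
    pdz k (fun z => z j * f z) = fun z => (if j = k then f z else 0) + z j * pdz k f z := by
  ext z
  have h : HasFDerivAt (fun z : Cn n => z j * f z) _ z :=
    (hasFDerivAt_apply j z).mul (hf z).hasFDerivAt
  rw [pdz, h.fderiv]
  by_cases hjk : j = k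
  · subst hjk
    simp [pdz, add_comm]
  · simp [pdz, hjk]

theorem gInner_coord_coord {n : ℕ} {f g : Cn n → ℂ} (hf : MemFPlus f) (hg : MemFPlus g)
    {t : ℝ} (ht : 1 < t) (j k : Fin n) :
    (t : ℂ) ^ 2 * gInner t (fun z => z j * f z) (fun z => z k * g z)
      = (if j = k then t * gInner t f g else 0) + gInner t (pdz k f) (pdz j g) := by
  have h1 := gInner_pdz_left (hf.coord_mul j) hg ht k
  have h2 := congrArg (starRingEnd ℂ) (gInner_pdz_left hg (hf.pdz k) ht j)
  rw [map_mul, gInner_conj, gInner_conj, Complex.conj_ofReal] at h2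
  have h3 : gInner t (pdz k fun z => z j * f z) g
      = (if j = k then gInner t f g else 0) + gInner t (fun z => z j * pdz k f z) g := by
    rw [pdz_coord_mul hf.1]
    have i1 := hf.integrable_mul_conj hg ht
    have i2 := ((hf.pdz k).coord_mul j).integrable_mul_conj hg ht
    split_ifs
    · simp only [gInner, add_mul]
      exact integral_add i1 i2
    · simp only [zero_add]
  rw [h2]
  rw [pow_two, mul_assoc, ← h1, h3]
  split_ifs <;> ring

/-- The squared norm `∫ |f|² e^{-t|z|²} dλ`. -/
def gNormSq {n : ℕ} (t : ℝ) (f : Cn n → ℂ) : ℝ := ∫ z : Cn n, ‖f z‖ ^ 2 * gWt t z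

theorem ofReal_gNormSq {n : ℕ} (t : ℝ) (f : Cn n → ℂ) : (gNormSq t f : ℂ) = gInner t f f := by
  rw [gNormSq, gInner, ← integral_complex_ofReal]
  congr 1
  ext z
  rw [Complex.mul_conj, Complex.normSq_eq_norm_sq]
  push_cast
  rfl

theorem gInner_sum_sum {n : ℕ} {ι : Type*} {t : ℝ} (ht : 1 < t) (s : Finset ι) (a : ι → ℂ)
    {f : ι → Cn n → ℂ} (hf : ∀ i ∈ s, MemFPlus (f i)) :
    gInner t (fun z => ∑ i ∈ s, a i * f i z) (fun z => ∑ i ∈ s, a i * f i z)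
      = ∑ i ∈ s, ∑ j ∈ s, a i * (starRingEnd ℂ) (a j) * gInner t (f i) (f j) := by
  have hexp : ∀ z : Cn n, (∑ i ∈ s, a i * f i z) * (starRingEnd ℂ) (∑ i ∈ s, a i * f i z) * gWt t z
      = ∑ i ∈ s, ∑ j ∈ s, a i * (starRingEnd ℂ) (a j)
        * (f i z * (starRingEnd ℂ) (f j z) * gWt t z) := fun z => by
    rw [map_sum, Finset.sum_mul_sum, Finset.sum_mul]
    refine Finset.sum_congr rfl fun i _ => ?_
    rw [Finset.sum_mul]
    refine Finset.sum_congr rfl fun j _ => ?_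
    rw [map_mul]
    ring
  have hint : ∀ i ∈ s, ∀ j ∈ s, Integrable fun z : Cn n => a i * (starRingEnd ℂ) (a j)
      * (f i z * (starRingEnd ℂ) (f j z) * gWt t z) := fun i hi j hj =>
    ((hf i hi).integrable_mul_conj (hf j hj) ht).const_mul _
  simp only [gInner, hexp]
  rw [integral_finsetSum _ fun i hi => integrable_finsetSum _ (hint i hi)]
  refine Finset.sum_congr rfl fun i hi => ?_
  rw [integral_finsetSum _ (hint i hi)]
  exact Finset.sum_congr rfl fun j _ => integral_const_mul _ _

theorem conj_sgn {n : ℕ} (j : Fin n) (J : Finset (Fin n)) : (starRingEnd ℂ) (sgn j J) = sgn j J := by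
  simp [sgn]

theorem sgn_mul_self {n : ℕ} (j : Fin n) (J : Finset (Fin n)) : sgn j J * sgn j J = 1 := by
  rw [sgn, ← mul_pow]; simp

theorem sgn_insert_mul_sgn_insert {n : ℕ} {j k : Fin n} {K : Finset (Fin n)} (hjk : j ≠ k)
    (hj : j ∉ K) (hk : k ∉ K) :
    sgn j (insert k K) * sgn k (insert j K) = -(sgn j K * sgn k K) := by
  unfold sgn
  rw [Finset.filter_insert, Finset.filter_insert]
  rcases lt_or_gt_of_ne hjk with h | h
  · rw [if_neg h.not_gt, if_pos h, Finset.card_insert_of_notMem (by simp [hj])]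
    ring
  · rw [if_pos h, if_neg h.not_gt, Finset.card_insert_of_notMem (by simp [hk])]
    ring

theorem sum_mem_eq_sum_notMem_insert {n : ℕ} {M : Type*} [AddCommMonoid M]
    (F : Fin n → Finset (Fin n) → M) :
    ∑ L : Finset (Fin n), ∑ j ∈ L, F j (L.erase j) = ∑ K : Finset (Fin n), ∑ j ∈ Kᶜ, F j K := by
  rw [Finset.sum_sigma', Finset.sum_sigma']
  refine Finset.sum_bij' (fun x _ => ⟨x.1.erase x.2, x.2⟩) (fun x _ => ⟨insert x.2 x.1, x.2⟩)
    ?_ ?_ ?_ ?_ ?_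
  · simp
  · simp
  · rintro ⟨L, j⟩ h
    simp at h
    simp [Finset.insert_erase h]
  · rintro ⟨K, j⟩ h
    simp at h
    simp [Finset.erase_insert h]
  · simp

theorem sum_offDiag_eq_sum_offDiag_compl {n : ℕ} {M : Type*} [AddCommMonoid M]
    (F : Finset (Fin n) → Fin n → Fin n → M) :
    ∑ L : Finset (Fin n), ∑ x ∈ L.offDiag, F ((L.erase x.1).erase x.2) x.1 x.2
      = ∑ K : Finset (Fin n), ∑ x ∈ Kᶜ.offDiag, F K x.1 x.2 := by
  rw [Finset.sum_sigma', Finset.sum_sigma']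
  refine Finset.sum_bij' (fun x _ => ⟨(x.1.erase x.2.1).erase x.2.2, x.2⟩)
    (fun x _ => ⟨insert x.2.1 (insert x.2.2 x.1), x.2⟩) ?_ ?_ ?_ ?_ ?_
  · rintro ⟨L, j, k⟩ h
    simp at h
    simp [h.2.2]
  · rintro ⟨K, j, k⟩ h
    simp at h
    simp [h.2.2]
  · rintro ⟨L, j, k⟩ h
    simp at h
    simp [Finset.insert_erase, h, Ne.symm h.2.2]
  · rintro ⟨K, j, k⟩ h
    simp at h
    simp [h]
  · simp

theorem sum_sum_eq_diag_add_offDiag {ι M : Type*} [DecidableEq ι] [AddCommMonoid M]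
    (s : Finset ι) (F : ι → ι → M) :
    ∑ i ∈ s, ∑ j ∈ s, F i j = ∑ i ∈ s, F i i + ∑ x ∈ s.offDiag, F x.1 x.2 := by
  rw [← Finset.sum_product', ← Finset.diag_union_offDiag,
    Finset.sum_union (Finset.disjoint_diag_offDiag s), Finset.sum_diag]

theorem gNormSq_dOp {n : ℕ} {u : FormC n} (hu : ∀ J, MemFPlus (u J)) {t : ℝ} (ht : 1 < t) :
    ((∑ L, gNormSq t (dOp u L) : ℝ) : ℂ)
      = ∑ K : Finset (Fin n), ∑ j ∈ Kᶜ, gInner t (pdz j (u K)) (pdz j (u K))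
        - ∑ K : Finset (Fin n), ∑ x ∈ Kᶜ.offDiag, sgn x.1 K * sgn x.2 K
          * gInner t (pdz x.1 (u (insert x.2 K))) (pdz x.2 (u (insert x.1 K))) := by
  have hL : ∀ L, (gNormSq t (dOp u L) : ℂ)
      = ∑ j ∈ L, gInner t (pdz j (u (L.erase j))) (pdz j (u (L.erase j)))
        + ∑ x ∈ L.offDiag, -(sgn x.1 ((L.erase x.1).erase x.2) * sgn x.2 ((L.erase x.1).erase x.2)
          * gInner t (pdz x.1 (u (insert x.2 ((L.erase x.1).erase x.2))))
            (pdz x.2 (u (insert x.1 ((L.erase x.1).erase x.2))))) := by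
    intro L
    rw [ofReal_gNormSq]
    unfold dOp
    rw [gInner_sum_sum ht L (fun j => sgn j (L.erase j)) (f := fun j => pdz j (u (L.erase j)))
      fun j _ => (hu _).pdz j, sum_sum_eq_diag_add_offDiag]
    congr 1
    · refine Finset.sum_congr rfl fun j _ => ?_
      rw [conj_sgn, sgn_mul_self, one_mul]
    · refine Finset.sum_congr rfl ?_
      rintro ⟨j, k⟩ h
      obtain ⟨hj, hk, hjk⟩ := Finset.mem_offDiag.1 h
      have e1 : insert k ((L.erase j).erase k) = L.erase j :=
        Finset.insert_erase (Finset.mem_erase.2 ⟨hjk.symm, hk⟩)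
      have e2 : insert j ((L.erase j).erase k) = L.erase k := by
        rw [Finset.erase_right_comm]
        exact Finset.insert_erase (Finset.mem_erase.2 ⟨hjk, hj⟩)
      have hs := sgn_insert_mul_sgn_insert (K := (L.erase j).erase k) hjk (by simp) (by simp)
      rw [e1, e2] at hs
      simp only [e1, e2, conj_sgn, hs]
      ring
  rw [Complex.ofReal_sum, Finset.sum_congr rfl fun L _ => hL L, Finset.sum_add_distrib,
    sum_mem_eq_sum_notMem_insert fun j K => gInner t (pdz j (u K)) (pdz j (u K)),
    sum_offDiag_eq_sum_offDiag_compl fun K j k => -(sgn j K * sgn k K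
      * gInner t (pdz j (u (insert k K))) (pdz k (u (insert j K))))]
  simp only [Finset.sum_neg_distrib, sub_eq_add_neg]

theorem gNormSq_dStarOp {n : ℕ} {u : FormC n} (hu : ∀ J, MemFPlus (u J)) {t : ℝ} (ht : 1 < t) :
    (t : ℂ) ^ 2 * ((∑ K, gNormSq t (dStarOp u K) : ℝ) : ℂ)
      = ∑ J : Finset (Fin n), ∑ j ∈ J,
          (t * gInner t (u J) (u J) + gInner t (pdz j (u J)) (pdz j (u J)))
        + ∑ K : Finset (Fin n), ∑ x ∈ Kᶜ.offDiag, sgn x.1 K * sgn x.2 K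
          * gInner t (pdz x.1 (u (insert x.2 K))) (pdz x.2 (u (insert x.1 K))) := by
  have hK : ∀ K, (t : ℂ) ^ 2 * (gNormSq t (dStarOp u K) : ℂ)
      = ∑ j ∈ Kᶜ, (t * gInner t (u (insert j K)) (u (insert j K))
          + gInner t (pdz j (u (insert j K))) (pdz j (u (insert j K))))
        + ∑ x ∈ Kᶜ.offDiag, sgn x.1 K * sgn x.2 K
          * gInner t (pdz x.1 (u (insert x.2 K))) (pdz x.2 (u (insert x.1 K))) := by
    intro K
    rw [ofReal_gNormSq]
    unfold dStarOp
    rw [gInner_sum_sum ht Kᶜ (fun j => sgn j K) (f := fun j z => z j * u (insert j K) z)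
      fun j _ => (hu _).coord_mul j, Finset.sum_comm, Finset.mul_sum]
    simp only [Finset.mul_sum]
    rw [sum_sum_eq_diag_add_offDiag]
    congr 1
    · refine Finset.sum_congr rfl fun j _ => ?_
      rw [conj_sgn, sgn_mul_self, one_mul, gInner_coord_coord (hu _) (hu _) ht, if_pos rfl]
    · refine Finset.sum_congr rfl ?_
      rintro ⟨j, k⟩ h
      obtain ⟨hj, hk, hjk⟩ := Finset.mem_offDiag.1 h
      have hcc := gInner_coord_coord (hu (insert k K)) (hu (insert j K)) ht k j
      rw [if_neg hjk.symm, zero_add] at hcc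
      simp only [conj_sgn]
      rw [← hcc]
      ring
  have hre : ∑ K : Finset (Fin n), ∑ j ∈ Kᶜ, (t * gInner t (u (insert j K)) (u (insert j K))
        + gInner t (pdz j (u (insert j K))) (pdz j (u (insert j K))))
      = ∑ J : Finset (Fin n), ∑ j ∈ J,
          (t * gInner t (u J) (u J) + gInner t (pdz j (u J)) (pdz j (u J))) := by
    rw [← sum_mem_eq_sum_notMem_insert fun j K => (t * gInner t (u (insert j K)) (u (insert j K))
        + gInner t (pdz j (u (insert j K))) (pdz j (u (insert j K))))]
    refine Finset.sum_congr rfl fun J _ => Finset.sum_congr rfl fun j hj => ?_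
    rw [Finset.insert_erase hj]
  rw [Complex.ofReal_sum, Finset.mul_sum, Finset.sum_congr rfl fun K _ => hK K,
    Finset.sum_add_distrib, hre]

theorem gNormSq_dOp_add_dStarOp {n : ℕ} {u : FormC n} (hu : ∀ J, MemFPlus (u J)) {t : ℝ}
    (ht : 1 < t) :
    ∑ L, gNormSq t (dOp u L) + t ^ 2 * ∑ K, gNormSq t (dStarOp u K)
      = ∑ J : Finset (Fin n), ∑ j, gNormSq t (pdz j (u J))
        + t * ∑ J : Finset (Fin n), (J.card : ℝ) * gNormSq t (u J) := by
  apply Complex.ofReal_injective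
  rw [Complex.ofReal_add, Complex.ofReal_mul, Complex.ofReal_pow, gNormSq_dOp hu ht,
    gNormSq_dStarOp hu ht]
  push_cast
  simp only [ofReal_gNormSq]
  have hsplit : ∀ J : Finset (Fin n), ∑ j, gInner t (pdz j (u J)) (pdz j (u J))
      = ∑ j ∈ J, gInner t (pdz j (u J)) (pdz j (u J))
        + ∑ j ∈ Jᶜ, gInner t (pdz j (u J)) (pdz j (u J)) := fun J =>
    (Finset.sum_add_sum_compl J _).symm
  simp only [hsplit, Finset.sum_add_distrib, Finset.sum_const, nsmul_eq_mul, Finset.mul_sum]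
  have hcomm : ∀ J : Finset (Fin n), (J.card : ℂ) * (t * gInner t (u J) (u J))
      = t * (J.card * gInner t (u J) (u J)) := fun J => by ring
  simp only [hcomm]
  ring

theorem tendsto_gNormSq {n : ℕ} {f : Cn n → ℂ} (hf : Continuous f)
    (hi : Integrable fun z : Cn n => ‖f z‖ ^ 2 * fWt z) {s : ℕ → ℝ} (hs : ∀ m, 1 < s m)
    (hlim : Tendsto s atTop (nhds 1)) :
    Tendsto (fun m => gNormSq (s m) f) atTop (nhds (fNormSq f)) := by
  refine tendsto_integral_of_dominated_convergence _
    (fun m => ((hf.norm.pow 2).mul (continuous_gWt_right (s m))).aestronglyMeasurable) hi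
    (fun m => Eventually.of_forall fun z => ?_) (Eventually.of_forall fun z => ?_)
  · rw [Real.norm_of_nonneg (mul_nonneg (by positivity) (gWt_pos _ z).le), fWt_eq_gWt_one]
    exact mul_le_mul_of_nonneg_left (gWt_antitone z (hs m).le) (by positivity)
  · rw [fWt_eq_gWt_one]
    exact ((continuous_gWt.comp (Continuous.prodMk_left z)).tendsto 1 |>.comp hlim).const_mul _

theorem integrable_of_gNormSq_le {n : ℕ} {f : Cn n → ℂ} (hf : MemFPlus f) {s : ℕ → ℝ}
    (hs : ∀ m, 1 < s m) (hlim : Tendsto s atTop (nhds 1)) {B : ℝ}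
    (hB : ∀ m, gNormSq (s m) f ≤ B) : Integrable fun z : Cn n => ‖f z‖ ^ 2 * fWt z := by
  have hfc := hf.1.continuous
  have hlow : ∫⁻ z : Cn n, ENNReal.ofReal (‖f z‖ ^ 2 * fWt z) ≤ ENNReal.ofReal B := by
    calc ∫⁻ z : Cn n, ENNReal.ofReal (‖f z‖ ^ 2 * fWt z)
        = ∫⁻ z : Cn n, liminf (fun m => ENNReal.ofReal (‖f z‖ ^ 2 * gWt (s m) z)) atTop := by
          refine lintegral_congr fun z => (Tendsto.liminf_eq ?_).symm
          refine (ENNReal.continuous_ofReal.tendsto _).comp ?_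
          rw [fWt_eq_gWt_one]
          exact ((continuous_gWt.comp (Continuous.prodMk_left z)).tendsto 1
            |>.comp hlim).const_mul _
      _ ≤ liminf (fun m => ∫⁻ z : Cn n, ENNReal.ofReal (‖f z‖ ^ 2 * gWt (s m) z)) atTop :=
          lintegral_liminf_le fun m =>
            ((hfc.norm.pow 2).mul (continuous_gWt_right (s m))).measurable.ennreal_ofReal
      _ ≤ liminf (fun _ : ℕ => ENNReal.ofReal B) atTop := by
          refine liminf_le_liminf (Eventually.of_forall fun m => ?_)
          rw [← ofReal_integral_eq_lintegral_ofReal (hf.2 _ (hs m))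
            (Eventually.of_forall fun z => mul_nonneg (by positivity) (gWt_pos _ z).le)]
          exact ENNReal.ofReal_le_ofReal (hB m)
      _ = ENNReal.ofReal B := liminf_const _
  have hmeas : AEStronglyMeasurable (fun z : Cn n => ‖f z‖ ^ 2 * fWt z) volume := by
    simp only [fWt_eq_gWt_one]
    exact ((hfc.norm.pow 2).mul (continuous_gWt_right 1)).aestronglyMeasurable
  refine ⟨hmeas, ?_⟩
  have hnonneg : ∀ z : Cn n, 0 ≤ ‖f z‖ ^ 2 * fWt z := fun z =>
    mul_nonneg (by positivity) (Real.exp_pos _).le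
  rw [hasFiniteIntegral_iff_ofReal (Eventually.of_forall hnonneg)]
  exact hlow.trans_lt ENNReal.ofReal_lt_top

theorem gNormSq_nonneg {n : ℕ} (t : ℝ) (f : Cn n → ℂ) : 0 ≤ gNormSq t f :=
  integral_nonneg fun z => mul_nonneg (by positivity) (gWt_pos t z).le

theorem formNormSq_dOp_add_dStarOp {n : ℕ} {u : FormC n} (h1 : domD u) (h2 : domDs u) :
    formNormSq (dOp u) + formNormSq (dStarOp u)
      = ∑ J : Finset (Fin n), ∑ j, fNormSq (pdz j (u J))
        + ∑ J : Finset (Fin n), (J.card : ℝ) * fNormSq (u J) := by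
  have hu : ∀ J, MemFPlus (u J) := fun J => (h1.1 J).memFPlus
  set s : ℕ → ℝ := fun m => 1 + 1 / ((m : ℝ) + 1) with hsdef
  have hs : ∀ m, 1 < s m := fun m => lt_add_of_pos_right _ (by positivity)
  have hlim : Tendsto s atTop (nhds 1) := by
    simpa [hsdef] using tendsto_one_div_add_atTop_nhds_zero_nat.const_add (1 : ℝ)
  have hmem : ∀ {f : Cn n → ℂ}, MemF f →
      Tendsto (fun m => gNormSq (s m) f) atTop (nhds (fNormSq f)) := fun hf =>
    tendsto_gNormSq hf.1.continuous hf.2 hs hlim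
  have hL : Tendsto (fun m => ∑ L, gNormSq (s m) (dOp u L)
      + s m ^ 2 * ∑ K, gNormSq (s m) (dStarOp u K)) atTop
      (nhds (formNormSq (dOp u) + formNormSq (dStarOp u))) := by
    have := (tendsto_finsetSum Finset.univ fun L _ => hmem (h1.2 L)).add
      ((hlim.pow 2).mul (tendsto_finsetSum Finset.univ fun K _ => hmem (h2.2 K)))
    simpa [formNormSq] using this
  obtain ⟨B, hB⟩ := hL.bddAbove_range
  have hbound : ∀ (J : Finset (Fin n)) (j : Fin n) (m : ℕ), gNormSq (s m) (pdz j (u J)) ≤ B := by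
    intro J j m
    have hle := hB (Set.mem_range_self m)
    simp only [gNormSq_dOp_add_dStarOp hu (hs m)] at hle
    have hrest : 0 ≤ s m * ∑ J : Finset (Fin n), (J.card : ℝ) * gNormSq (s m) (u J) :=
      mul_nonneg (zero_le_one.trans (hs m).le)
        (Finset.sum_nonneg fun J _ => mul_nonneg (by positivity) (gNormSq_nonneg _ _))
    have hj : gNormSq (s m) (pdz j (u J)) ≤ ∑ i, gNormSq (s m) (pdz i (u J)) :=
      Finset.single_le_sum (f := fun i => gNormSq (s m) (pdz i (u J)))
        (fun i _ => gNormSq_nonneg _ _) (Finset.mem_univ j)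
    have hJ : ∑ i, gNormSq (s m) (pdz i (u J))
        ≤ ∑ J : Finset (Fin n), ∑ i, gNormSq (s m) (pdz i (u J)) :=
      Finset.single_le_sum (f := fun J => ∑ i, gNormSq (s m) (pdz i (u J)))
        (fun J _ => Finset.sum_nonneg fun i _ => gNormSq_nonneg _ _) (Finset.mem_univ J)
    linarith
  have hR : Tendsto (fun m => ∑ J : Finset (Fin n), ∑ j, gNormSq (s m) (pdz j (u J))
      + s m * ∑ J : Finset (Fin n), (J.card : ℝ) * gNormSq (s m) (u J)) atTop
      (nhds (∑ J : Finset (Fin n), ∑ j, fNormSq (pdz j (u J))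
        + 1 * ∑ J : Finset (Fin n), (J.card : ℝ) * fNormSq (u J))) := by
    refine (tendsto_finsetSum _ fun J _ => tendsto_finsetSum _ fun j _ => ?_).add
      (hlim.mul (tendsto_finsetSum _ fun J _ => (hmem (h1.1 J)).const_mul _))
    have hp := (hu J).pdz j
    exact tendsto_gNormSq hp.1.continuous
      (integrable_of_gNormSq_le hp hs hlim (hbound J j)) hs hlim
  rw [one_mul] at hR
  refine tendsto_nhds_unique hL (hR.congr fun m => ?_)
  exact (gNormSq_dOp_add_dStarOp hu (hs m)).symm

theorem fNormSq_zero {n : ℕ} : fNormSq (0 : Cn n → ℂ) = 0 := by simp [fNormSq]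

theorem pdz_zero {n : ℕ} (j : Fin n) : pdz j (0 : Cn n → ℂ) = 0 := by
  ext z
  simp [pdz]

/-- For a `(p,0)`-form `u ∈ dom ∂ ∩ dom ∂*` with Fock-space coefficients,
`1 ≤ p ≤ n−1`:
`‖∂u‖² + ‖∂*u‖² = Σ'_J Σ_j ‖∂u_J/∂z_j‖² + p Σ'_J ∫ |u_J|² e^{-|z|²} dλ`. -/
theorem stmt9 {n p : ℕ} (hp : 1 ≤ p) (hpn : p ≤ n - 1)
    (u : FormC n) (hdeg : IsDeg p u) (h1 : domD u) (h2 : domDs u) :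
    formNormSq (dOp u) + formNormSq (dStarOp u)
      = (∑ J ∈ Finset.univ.filter (fun J : Finset (Fin n) => J.card = p),
          ∑ j, fNormSq (pdz j (u J)))
        + p * (∑ J ∈ Finset.univ.filter (fun J : Finset (Fin n) => J.card = p),
            fNormSq (u J)) := by
  rw [formNormSq_dOp_add_dStarOp h1 h2, Finset.mul_sum]
  congr 1
  · refine (Finset.sum_filter_of_ne fun J _ hJ => ?_).symm
    by_contra hcard
    exact hJ (by simp [hdeg J hcard, pdz_zero, fNormSq_zero])
  · rw [Finset.sum_filter]
    refine Finset.sum_congr rfl fun J _ => ?_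
    split_ifs with hcard
    · rw [hcard]
    · simp [hdeg J hcard, fNormSq_zero]
end
end
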